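/- Fix a prime number p. Let W be the set of non-associative words in variables X, Y, Z in which Z occurs exactly once, at the end. Then there exist integers β_w for w ∈ W, only finitely many of them nonzero, such that for every left brace (A,+,∘) of cardinality p^n with n < p−1 and all a, b ∈ pA and c ∈ A: (a+b)*c = a*c + b*c + a*(b*c) − (a*b)*c + Σ_{w∈W} β_w·w⟨a,b,c⟩, where w⟨a,b,c⟩ is the evaluation of w at X = a, Y = b, Z = c under the operation *. -/

import Mathlib

universe u

/-- A left brace: `(A,+)` abelian group, `(A,∘)` a group, with
`a∘(b+c)+a = a∘b+a∘c`. -/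
structure LeftBrace (A : Type u) [AddCommGroup A] where
  circ : A → A → A
  one : A
  inv : A → A
  circ_assoc : ∀ a b c : A, circ (circ a b) c = circ a (circ b c)
  one_circ : ∀ a : A, circ one a = a
  circ_one : ∀ a : A, circ a one = a
  inv_circ : ∀ a : A, circ (inv a) a = one
  circ_add : ∀ a b c : A, circ a (b + c) + a = circ a b + circ a c

/-- `a*b = a∘b - a - b`. -/
def LeftBrace.star {A : Type u} [AddCommGroup A] (B : LeftBrace A) (a b : A) : A :=
  B.circ a b - a - b

/-- `ann(k) = {a : k•a = 0}`, as an additive subgroup. -/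
def annSub (A : Type u) [AddCommGroup A] (k : ℕ) : AddSubgroup A where
  carrier := {a : A | k • a = 0}
  zero_mem' := by simp
  add_mem' := by
    intro a b ha hb
    have ha' : k • a = 0 := ha
    have hb' : k • b = 0 := hb
    show k • (a + b) = 0
    rw [smul_add, ha', hb', add_zero]
  neg_mem' := by
    intro a ha
    have ha' : k • a = 0 := ha
    show k • (-a) = 0
    rw [smul_neg, ha', neg_zero]

/-- The coset `[a]` of `a` in `A/ann(k)`. -/
def qmk {A : Type u} [AddCommGroup A] (k : ℕ) (a : A) : A ⧸ annSub A k :=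
  QuotientAddGroup.mk a

/-- Evaluation of a non-associative word under a binary operation `op`,
substituting `f i` for the variable `i`. -/
def wEval {α : Type*} {β : Type*} (op : β → β → β) (f : α → β) : FreeMagma α → β
  | FreeMagma.of a => f a
  | FreeMagma.mul x y => op (wEval op f x) (wEval op f y)

/-- The list of leaves (occurrences of variables, left to right) of a word. -/
def wLeaves {α : Type*} : FreeMagma α → List α
  | FreeMagma.of a => [a]
  | FreeMagma.mul x y => wLeaves x ++ wLeaves y

/-- The last (rightmost) variable of a word. -/
def wLast {α : Type*} : FreeMagma α → α
  | FreeMagma.of a => a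
  | FreeMagma.mul _ y => wLast y

/-- The number of occurrences of the variable `a` in a word. -/
def wCount {α : Type*} [DecidableEq α] (a : α) : FreeMagma α → ℕ
  | FreeMagma.of b => if b = a then 1 else 0
  | FreeMagma.mul x y => wCount a x + wCount a y

/-- The length (number of variable occurrences) of a word. -/
def wLen {α : Type*} : FreeMagma α → ℕ
  | FreeMagma.of _ => 1
  | FreeMagma.mul x y => wLen x + wLen y

/-- Left-normed product `a₁·(a₂·(⋯(aₘ·b)⋯))`. -/
def leftProd {Q : Type*} (mul : Q → Q → Q) : List Q → Q → Q
  | [], b => b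
  | a :: l, b => mul a (leftProd mul l b)

/-- `circPow B a k` is the product of `k` copies of `a` under `∘`. -/
def circPow {A : Type u} [AddCommGroup A] (B : LeftBrace A) (a : A) : ℕ → A
  | 0 => B.one
  | k + 1 => B.circ a (circPow B a k)

/-- `eSeq B a (i-1)` is `a_i`, where `a_1 = a` and `a_{i+1} = a * a_i`. -/
def eSeq {A : Type u} [AddCommGroup A] (B : LeftBrace A) (a : A) : ℕ → A
  | 0 => a
  | i + 1 => B.star a (eSeq B a i)

/-- `starIter B a b (i-1)` is `e_i`, where `e_1 = a*b` and `e_{i+1} = a*e_i`. -/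
def starIter {A : Type u} [AddCommGroup A] (B : LeftBrace A) (a b : A) : ℕ → A
  | 0 => B.star a b
  | i + 1 => B.star a (starIter B a b i)

/-- `iterOp op u v i` is `u ⊙ (u ⊙ (⋯ (u ⊙ v)))` with `i` applications of `u ⊙ ·`. -/
def iterOp {Q : Type*} (op : Q → Q → Q) (u v : Q) : ℕ → Q
  | 0 => v
  | i + 1 => op u (iterOp op u v i)

/-- `f(a) = Σ_{i=1}^{p−1} (C(p−1,i−1)/i)·e_i` where `e_1 = a`, `e_{i+1} = a*e_i`. -/
def fMap {A : Type u} [AddCommGroup A] (B : LeftBrace A) (p : ℕ) (a : A) : A :=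
  ∑ i ∈ Finset.Icc 1 (p - 1), (Nat.choose (p - 1) (i - 1) / i) • eSeq B a (i - 1)

/-- `braceChainAux B (i-1)` is `A^i`: `A^1 = A`, `A^{i+1}` the additive subgroup
generated by `{x*y : x ∈ A, y ∈ A^i}`. -/
def braceChainAux {A : Type u} [AddCommGroup A] (B : LeftBrace A) : ℕ → AddSubgroup A
  | 0 => ⊤
  | i + 1 => AddSubgroup.closure {z : A | ∃ x : A, ∃ y ∈ braceChainAux B i, z = B.star x y}

/-- `dSeq B a b i = (d_i, d_i')`: `d_0 = a`, `d_0' = b`, `d_{i+1} = d_i + d_i'`,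
`d_{i+1}' = d_i * d_i'`. -/
def dSeq {A : Type u} [AddCommGroup A] (B : LeftBrace A) (a b : A) : ℕ → A × A
  | 0 => (a, b)
  | i + 1 => ((dSeq B a b i).1 + (dSeq B a b i).2, B.star (dSeq B a b i).1 (dSeq B a b i).2)


namespace LeftBrace

variable {A : Type u} [AddCommGroup A] (B : LeftBrace A)

theorem circ_zero' (a : A) : B.circ a 0 = a := by
  have h := B.circ_add a 0 0
  rw [add_zero] at h
  exact (add_left_cancel h).symm

theorem one_eq_zero : B.one = 0 := by
  have h := B.circ_zero' B.one
  rw [B.one_circ] at h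
  exact h.symm

/-- The additive endomorphism `c ↦ a∘c - a`. -/
def lam (a : A) : AddMonoid.End A :=
  AddMonoidHom.mk' (fun c => B.circ a c - a) (by
    intro x y
    have h := B.circ_add a x y
    have h2 : B.circ a (x + y) = B.circ a x + B.circ a y - a := eq_sub_of_add_eq h
    rw [h2]; abel)

theorem lam_apply (a c : A) : B.lam a c = B.circ a c - a := rfl

theorem lam_star (a c : A) : B.lam a c = c + B.star a c := by
  rw [lam_apply, star]; abel

theorem star_lam (a c : A) : B.star a c = B.lam a c - c := by
  rw [lam_star]; abel

theorem circ_lam (a c : A) : B.circ a c = a + B.lam a c := by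
  rw [lam_apply]; abel

theorem lam_circ (a b : A) : B.lam (B.circ a b) = B.lam a * B.lam b := by
  ext c
  have h : B.lam a (B.lam b c) = B.lam a (B.circ b c) - B.lam a b := by
    rw [B.lam_apply b c, map_sub]
  show _ = B.lam a (B.lam b c)
  rw [h, lam_apply, lam_apply, lam_apply, B.circ_assoc]
  abel

theorem lam_zero : B.lam 0 = 1 := by
  ext c
  show B.circ 0 c - 0 = c
  rw [← B.one_eq_zero, B.one_circ, B.one_eq_zero, sub_zero]

theorem star_add (a b c : A) : B.star a (b + c) = B.star a b + B.star a c := by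
  simp only [star_lam, map_add]; abel

theorem star_neg (a b : A) : B.star a (-b) = - B.star a b := by
  simp only [star_lam, map_neg]; abel

theorem star_zero (a : A) : B.star a 0 = 0 := by
  simp only [star_lam, map_zero]; abel

theorem star_sub (a b c : A) : B.star a (b - c) = B.star a b - B.star a c := by
  simp only [star_lam, map_sub]; abel

theorem zero_star (c : A) : B.star 0 c = 0 := by
  rw [star_lam, lam_zero]; simp

theorem circ_star (a b c : A) :
    B.star (B.circ a b) c = B.star a c + B.star b c + B.star a (B.star b c) := by
  rw [B.star_lam (B.circ a b), lam_circ]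
  show B.lam a (B.lam b c) - c = _
  rw [B.lam_star b c, map_add, B.lam_star, B.lam_star]
  abel

theorem lam_inv_mul (a : A) : B.lam (B.inv a) * B.lam a = 1 := by
  rw [← lam_circ, B.inv_circ, one_eq_zero, lam_zero]

/-- The multiplicative group of a brace on a type synonym. -/
def CG (_ : LeftBrace A) : Type u := A

instance : Group B.CG := 
  letI : Mul B.CG := ⟨B.circ⟩
  letI : One B.CG := ⟨B.one⟩
  letI : Inv B.CG := ⟨B.inv⟩
  Group.ofLeftAxioms B.circ_assoc B.one_circ B.inv_circ

theorem CG_mul (a b : B.CG) : a * b = B.circ a b := rfl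
theorem CG_inv (a : B.CG) : a⁻¹ = B.inv a := rfl
theorem CG_one : (1 : B.CG) = B.one := rfl

theorem lam_mul_inv (a : A) : B.lam a * B.lam (B.inv a) = 1 := by
  have h : B.circ a (B.inv a) = B.one := mul_inv_cancel (G := B.CG) a
  rw [← lam_circ, h, one_eq_zero, lam_zero]

/-- Upper series for the action. -/
def Zs : ℕ → AddSubgroup A
  | 0 => ⊥
  | i + 1 => 
    { carrier := {x | ∀ a, B.star a x ∈ Zs i}
      zero_mem' := by intro a; rw [star_zero]; exact zero_mem _
      add_mem' := by intro x y hx hy a; rw [star_add]; exact add_mem (hx a) (hy a)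
      neg_mem' := by intro x hx a; rw [star_neg]; exact neg_mem (hx a) }

theorem mem_Zs_succ (i : ℕ) (x : A) : x ∈ B.Zs (i+1) ↔ ∀ a, B.star a x ∈ B.Zs i := Iff.rfl

theorem Zs_star (i : ℕ) : ∀ x ∈ B.Zs i, ∀ a, B.star a x ∈ B.Zs i := by
  induction i with
  | zero =>
    intro x hx a
    have : x = 0 := hx
    rw [this, star_zero]; exact zero_mem _
  | succ i ih =>
    intro x hx a b
    exact ih _ (hx a) b

theorem Zs_le (i : ℕ) : B.Zs i ≤ B.Zs (i+1) := fun x hx a => B.Zs_star i x hx a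

theorem Zs_lam (i : ℕ) (x : A) (hx : x ∈ B.Zs i) (a : A) : B.lam a x ∈ B.Zs i := by
  rw [lam_star]; exact add_mem hx (B.Zs_star i x hx a)

/-- Action on the quotient by a member of the series. -/
@[reducible] def quotAct (i : ℕ) : MulAction B.CG (A ⧸ B.Zs i) where
  smul a := QuotientAddGroup.map (B.Zs i) (B.Zs i) (B.lam a) (fun x hx => B.Zs_lam i x hx a)
  one_smul := by
    intro x
    induction x using QuotientAddGroup.induction_on with
    | H x =>
    show QuotientAddGroup.mk (B.lam B.one x) = _
    rw [one_eq_zero, lam_zero]; rfl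
  mul_smul := by
    intro a b x
    induction x using QuotientAddGroup.induction_on with
    | H x =>
    show QuotientAddGroup.mk (B.lam (B.circ a b) x) = QuotientAddGroup.mk (B.lam a (B.lam b x))
    exact congrArg _ (congrArg (fun f : AddMonoid.End A => f x) (B.lam_circ a b))

theorem Zs_lt {p n : ℕ} (hp : p.Prime) (hA : Nat.card A = p ^ n) (i : ℕ) (hi : B.Zs i ≠ ⊤) :
    B.Zs i < B.Zs (i+1) := by
  haveI : Fact p.Prime := ⟨hp⟩
  haveI : Finite A := Nat.finite_of_card_ne_zero (by rw [hA]; exact pow_ne_zero _ hp.ne_zero)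
  have hG : IsPGroup p B.CG := IsPGroup.of_card (n := n) hA
  letI := B.quotAct i
  have hdvd : p ∣ Nat.card (A ⧸ B.Zs i) := by
    have h1 : Nat.card (A ⧸ B.Zs i) ∣ p ^ n := by
      rw [← hA]; exact (B.Zs i).index_dvd_card
    obtain ⟨k, hk, h2⟩ := (Nat.dvd_prime_pow hp).1 h1
    rw [h2]
    rcases k with _ | k
    · exfalso
      apply hi
      rw [← AddSubgroup.index_eq_one]
      rw [pow_zero] at h2
      exact h2
    · exact dvd_pow_self _ (by simp)
  have h0 : (0 : A ⧸ B.Zs i) ∈ MulAction.fixedPoints B.CG (A ⧸ B.Zs i) := by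
    intro a
    exact map_zero (QuotientAddGroup.map (B.Zs i) (B.Zs i) (B.lam a) (fun x hx => B.Zs_lam i x hx a))
  obtain ⟨y, hy, hne⟩ := hG.exists_fixed_point_of_prime_dvd_card_of_fixed_point
    (A ⧸ B.Zs i) hdvd h0
  induction y using QuotientAddGroup.induction_on with
  | H y =>
  refine lt_of_le_of_ne (B.Zs_le i) ?_
  intro heq
  apply hne
  symm
  rw [QuotientAddGroup.eq_zero_iff, heq]
  intro a
  have h := hy a
  have h' : (QuotientAddGroup.mk (B.lam a y) : A ⧸ B.Zs i) = QuotientAddGroup.mk y := h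
  rw [eq_comm, QuotientAddGroup.eq] at h'
  rw [star_lam]
  convert h' using 1
  abel

theorem Zs_card {p n : ℕ} (hp : p.Prime) (hA : Nat.card A = p ^ n) (i : ℕ) :
    B.Zs i = ⊤ ∨ ∃ k, i ≤ k ∧ Nat.card (B.Zs i) = p ^ k := by
  haveI : Finite A := Nat.finite_of_card_ne_zero (by rw [hA]; exact pow_ne_zero _ hp.ne_zero)
  induction i with
  | zero => right; exact ⟨0, le_rfl, by simp [Zs]⟩
  | succ i ih =>
    by_cases hi : B.Zs i = ⊤
    · left
      exact top_le_iff.1 (hi ▸ B.Zs_le i)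
    right
    rcases ih with h | ⟨k, hk, hc⟩
    · exact absurd h hi
    have hlt := B.Zs_lt hp hA i hi
    have h1 : Nat.card (B.Zs (i+1)) ∣ p ^ n := by
      rw [← hA]; exact AddSubgroup.card_addSubgroup_dvd_card _
    obtain ⟨l, _, h2⟩ := (Nat.dvd_prime_pow hp).1 h1
    refine ⟨l, ?_, h2⟩
    have h3 : Nat.card (B.Zs i) < Nat.card (B.Zs (i+1)) :=
      Set.Finite.card_lt_card (Set.toFinite (B.Zs (i+1) : Set A)) hlt
    rw [hc, h2] at h3
    have := (Nat.pow_lt_pow_iff_right hp.one_lt).1 h3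
    omega

theorem Zs_top {p n : ℕ} (hp : p.Prime) (hA : Nat.card A = p ^ n) : B.Zs n = ⊤ := by
  haveI : Finite A := Nat.finite_of_card_ne_zero (by rw [hA]; exact pow_ne_zero _ hp.ne_zero)
  rcases B.Zs_card hp hA n with h | ⟨k, hk, hc⟩
  · exact h
  apply AddSubgroup.eq_top_of_le_card
  rw [hA, hc]
  exact Nat.pow_le_pow_right hp.pos hk

/-- `E a c = a * c` as an endomorphism -/
def E (a : A) : AddMonoid.End A := B.lam a - 1

theorem E_apply (a c : A) : B.E a c = B.star a c := by
  rw [star_lam]; rfl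

theorem E_pow_mem (a : A) (j i : ℕ) (x : A) (hx : x ∈ B.Zs (i + j)) : (B.E a ^ j) x ∈ B.Zs i := by
  induction j generalizing x with
  | zero => simpa using hx
  | succ j ih =>
    rw [pow_succ]
    show (B.E a ^ j) (B.E a x) ∈ _
    apply ih
    rw [E_apply]
    exact hx a

theorem E_pow_mem' (a : A) (j i : ℕ) (x : A) (hx : x ∈ B.Zs (i + 1)) :
    (B.E a ^ (j+1)) x ∈ B.Zs i := by
  rw [pow_succ]
  show (B.E a ^ j) (B.E a x) ∈ _
  have h : B.E a x ∈ B.Zs i := by rw [E_apply]; exact hx a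
  generalize B.E a x = y at h
  induction j with
  | zero => simpa using h
  | succ j ih =>
    rw [pow_succ']
    show B.E a ((B.E a ^ j) y) ∈ _
    rw [E_apply]
    exact B.Zs_star i _ ih a

theorem E_pow_zero {p n : ℕ} (hp : p.Prime) (hA : Nat.card A = p ^ n) (a : A) (j : ℕ)
    (hj : n ≤ j) : B.E a ^ j = 0 := by
  have h : B.E a ^ n = 0 := by
    ext x
    have := B.E_pow_mem a n 0 x (by rw [zero_add, B.Zs_top hp hA]; trivial)
    exact this
  obtain ⟨k, rfl⟩ := Nat.exists_eq_add_of_le hj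
  rw [pow_add, h, zero_mul]

theorem circPow_lam (a : A) (k : ℕ) : B.lam (circPow B a k) = B.lam a ^ k := by
  induction k with
  | zero => simp [circPow, one_eq_zero, lam_zero]
  | succ k ih => rw [circPow, lam_circ, ih, pow_succ']

theorem circPow_sum (a : A) (k : ℕ) :
    circPow B a k = (∑ i ∈ Finset.range k, B.lam a ^ i) a := by
  induction k with
  | zero => simp [circPow, one_eq_zero]
  | succ k ih =>
    rw [circPow, circ_lam, ih, Finset.sum_range_succ']
    simp only [pow_succ', ← Finset.mul_sum]
    rw [pow_zero, add_comm]
    rfl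

end LeftBrace

theorem geom_choose {R : Type*} [Ring R] (x : R) (k : ℕ) :
    ∑ i ∈ Finset.range k, (x + 1) ^ i = ∑ i ∈ Finset.range k, (k.choose (i+1) : R) * x ^ i := by
  have h := congrArg (Polynomial.aeval (R := ℤ) x) (Polynomial.geom_sum_X_comp_X_add_one_eq_sum (R := ℤ) k)
  simpa [Polynomial.aeval_comp, map_sum] using h

theorem choose_dvd {p : ℕ} (hp : p.Prime) (i j : ℕ) (hj : j + 1 < p) :
    p ^ i ∣ (p ^ i).choose (j+1) := by
  have h : (p^i).choose (j+1) * (j+1) = p ^ i * (p^i - 1).choose j := by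
    have hpos : 0 < p ^ i := pow_pos hp.pos i
    have := Nat.add_one_mul_choose_eq (p^i - 1) j
    rw [Nat.sub_add_cancel hpos] at this
    exact this.symm
  have hc : Nat.Coprime (p ^ i) (j+1) := by
    apply Nat.Coprime.pow_left
    exact (hp.coprime_iff_not_dvd).2 (Nat.not_dvd_of_pos_of_lt (Nat.succ_pos j) hj)
  exact hc.dvd_of_dvd_mul_right ⟨_, h⟩

namespace LeftBrace

section
variable {A : Type u} [AddCommGroup A] (B : LeftBrace A)

theorem powSum {p n : ℕ} (hp : p.Prime) (hn : n < p - 1) (hA : Nat.card A = p ^ n) (a : A)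
    (k : ℕ) : ∃ (m : ℕ) (d : ℕ → ℕ),
      ∑ i ∈ Finset.range (p ^ k), B.lam a ^ i =
        ((p ^ k : ℕ) : AddMonoid.End A) *
          (1 + ∑ j ∈ Finset.range m, (d j : AddMonoid.End A) * B.E a ^ (j + 1)) := by
  have hl : B.lam a = B.E a + 1 := by rw [E]; abel
  have hpos : 0 < p ^ k := pow_pos hp.pos k
  refine ⟨p ^ k - 1, fun j => (p ^ k).choose (j + 2) / p ^ k, ?_⟩
  rw [hl, geom_choose]
  obtain ⟨q, hq⟩ : ∃ q, p ^ k = q + 1 := ⟨p ^ k - 1, by omega⟩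
  have key : ∀ j, ((p ^ k).choose (j + 2) : AddMonoid.End A) * B.E a ^ (j + 1) =
      ((p ^ k : ℕ) : AddMonoid.End A) *
        ((((p ^ k).choose (j + 2) / p ^ k : ℕ) : AddMonoid.End A) * B.E a ^ (j + 1)) := by
    intro j
    by_cases hj : j + 2 < p
    · rw [← mul_assoc, ← Nat.cast_mul, Nat.mul_div_cancel' (choose_dvd hp k (j + 1) hj)]
    · rw [B.E_pow_zero hp hA a (j + 1) (by omega)]
      simp only [mul_zero]
  rw [mul_add, Finset.mul_sum]
  simp only [← key]
  rw [hq, Finset.sum_range_succ', add_comm]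
  simp

theorem natCast_end (q : ℕ) (f : AddMonoid.End A) (x : A) :
    ((q : AddMonoid.End A) * f) x = q • f x := rfl

theorem lam_smul {p n : ℕ} (hp : p.Prime) (hn : n < p - 1) (hA : Nat.card A = p ^ n)
    (k i : ℕ) : ∀ x ∈ B.Zs i, ∃ h : AddMonoid.End A,
      B.lam ((p ^ k) • x) = 1 + ((p ^ k : ℕ) : AddMonoid.End A) * h := by
  induction i with
  | zero =>
    intro x hx
    have hx' : x = 0 := hx
    refine ⟨0, ?_⟩
    rw [hx', smul_zero, mul_zero, lam_zero, add_zero]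
  | succ i ih =>
    intro x hx
    obtain ⟨m, d, hS⟩ := B.powSum hp hn hA x k
    set T : AddMonoid.End A :=
      ∑ j ∈ Finset.range m, (d j : AddMonoid.End A) * B.E x ^ (j + 1) with hT
    set q := p ^ k with hq
    have hw : T x ∈ B.Zs i := by
      have hTx : T x = ∑ j ∈ Finset.range m, ((d j : AddMonoid.End A) * B.E x ^ (j + 1)) x :=
        map_sum (AddMonoidHom.eval x : (A →+ A) →+ A) _ _
      rw [hTx]
      refine sum_mem ?_
      intro j _
      exact nsmul_mem (B.E_pow_mem' x j i x hx) _
    set y := circPow B x q with hy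
    have hyx : y = q • x + q • T x := by
      rw [hy, circPow_sum, hS]
      show q • (x + T x) = _
      rw [smul_add]
    obtain ⟨h', hh'⟩ := ih (B.lam (B.inv y) (-T x)) (B.Zs_lam i _ (neg_mem hw) _)
    have h1 : q • x = B.circ y (q • (B.lam (B.inv y) (-T x))) := by
      rw [circ_lam, map_nsmul]
      have : B.lam y (B.lam (B.inv y) (-T x)) = -T x :=
        congrArg (fun f : AddMonoid.End A => f (-T x)) (B.lam_mul_inv y)
      rw [this, hyx, smul_neg]
      abel
    have h2 : B.lam y = 1 + (q : AddMonoid.End A) * ((1 + T) * B.E x) := by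
      rw [hy, circPow_lam]
      have hg := geom_sum_mul (B.lam x) q
      rw [hS] at hg
      rw [← mul_assoc]
      change (q : AddMonoid.End A) * (1 + T) * B.E x = _ at hg
      rw [hg]
      abel
    refine ⟨(1 + T) * B.E x + h' + (1 + T) * B.E x * (q * h'), ?_⟩
    rw [h1, lam_circ, h2, hh']
    generalize (1 + T) * B.E x = f
    generalize (q : AddMonoid.End A) = r
    noncomm_ring

theorem star_pow {p n : ℕ} (hp : p.Prime) (hn : n < p - 1) (hA : Nat.card A = p ^ n)
    (i j : ℕ) (x y : A) : ∃ z, B.star ((p ^ i) • x) ((p ^ j) • y) = (p ^ (i + j)) • z := by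
  obtain ⟨h, hh⟩ := B.lam_smul hp hn hA i n x (by rw [B.Zs_top hp hA]; trivial)
  refine ⟨h y, ?_⟩
  rw [star_lam, hh]
  show (p ^ j) • y + (p ^ i) • h ((p ^ j) • y) - (p ^ j) • y = _
  rw [map_nsmul, smul_smul, pow_add, add_sub_cancel_left]

theorem word_pow {p n : ℕ} (hp : p.Prime) (hn : n < p - 1) (hA : Nat.card A = p ^ n)
    (a b c : A) (ha : ∃ x : A, a = p • x) (hb : ∃ y : A, b = p • y) (w : FreeMagma (Fin 3))
    (hw : wCount (2 : Fin 3) w = 0) :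
    ∃ z, wEval B.star ![a, b, c] w = (p ^ wLen w) • z := by
  induction w using FreeMagma.rec with
  | of i =>
    fin_cases i
    · simpa [wEval, wLen] using ha
    · simpa [wEval, wLen] using hb
    · simp [wCount] at hw
  | mul v w hv hw' =>
    have h0 : wCount (2 : Fin 3) v + wCount (2 : Fin 3) w = 0 := hw
    obtain ⟨x, hx⟩ := hv (by omega)
    obtain ⟨y, hy⟩ := hw' (by omega)
    obtain ⟨z, hz⟩ := B.star_pow hp hn hA (wLen v) (wLen w) x y
    refine ⟨z, ?_⟩
    show B.star (wEval B.star ![a, b, c] v) (wEval B.star ![a, b, c] w) = _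
    rw [hx, hy, hz]
    rfl

theorem word_zero {p n : ℕ} (hp : p.Prime) (hn : n < p - 1) (hA : Nat.card A = p ^ n)
    (a b c : A) (ha : ∃ x : A, a = p • x) (hb : ∃ y : A, b = p • y) (w : FreeMagma (Fin 3))
    (hw : wCount (2 : Fin 3) w = 0) (hl : p ≤ wLen w) :
    wEval B.star ![a, b, c] w = 0 := by
  obtain ⟨z, hz⟩ := B.word_pow hp hn hA a b c ha hb w hw
  obtain ⟨k, hk⟩ : ∃ k, wLen w = n + k := ⟨wLen w - n, by omega⟩
  rw [hz, hk, pow_add, mul_comm, mul_smul, ← hA, card_nsmul_eq_zero', smul_zero]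

end

section
variable {U : Type*} [AddCommGroup U] (B : LeftBrace U) (a b c : U)

/-- Span of the words in the first two variables of length at least `m`. -/
def Fs (m : ℕ) : AddSubgroup U :=
  AddSubgroup.closure {z | ∃ w, wCount (2 : Fin 3) w = 0 ∧ m ≤ wLen w ∧
    wEval B.star ![a, b, c] w = z}

/-- Span of the words in which the last variable occurs once, at the end. -/
def Vs : AddSubgroup U :=
  AddSubgroup.closure {z | ∃ w, (wLast w = (2 : Fin 3) ∧ wCount (2 : Fin 3) w = 1) ∧
    wEval B.star ![a, b, c] w = z}

/-- Left multiplication by `x` respects the spans. -/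
def Good (x : U) : Prop :=
  (∀ i, ∀ y ∈ B.Fs a b c i, B.star x y ∈ B.Fs a b c (i + 1)) ∧
    ∀ v ∈ B.Vs a b c, B.star x v ∈ B.Vs a b c

theorem Fs_le (m : ℕ) : B.Fs a b c (m + 1) ≤ B.Fs a b c m := by
  apply AddSubgroup.closure_mono
  rintro z ⟨w, h1, h2, h3⟩
  exact ⟨w, h1, by omega, h3⟩

theorem wLen_pos {α : Type*} (w : FreeMagma α) : 0 < wLen w := by
  induction w using FreeMagma.rec with
  | of i => exact Nat.one_pos
  | mul v w hv hw => exact Nat.add_pos_left hv _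

theorem good_word (w : FreeMagma (Fin 3)) (hw : wCount (2 : Fin 3) w = 0) :
    B.Good a b c (wEval B.star ![a, b, c] w) := by
  constructor
  · intro i y hy
    induction hy using AddSubgroup.closure_induction with
    | mem y hy =>
      obtain ⟨v, h1, h2, rfl⟩ := hy
      apply AddSubgroup.subset_closure
      have := wLen_pos w
      refine ⟨FreeMagma.mul w v, ?_, ?_, rfl⟩
      · show _ + _ = 0
        omega
      · show _ ≤ _ + _
        omega
    | zero => rw [star_zero]; exact zero_mem _
    | add x y _ _ hx hy => rw [star_add]; exact add_mem hx hy
    | neg x _ hx => rw [star_neg]; exact neg_mem hx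
  · intro y hy
    induction hy using AddSubgroup.closure_induction with
    | mem y hy =>
      obtain ⟨v, ⟨h1, h2⟩, rfl⟩ := hy
      apply AddSubgroup.subset_closure
      refine ⟨FreeMagma.mul w v, ⟨h1, ?_⟩, rfl⟩
      show _ + _ = 1
      omega
    | zero => rw [star_zero]; exact zero_mem _
    | add x y _ _ hx hy => rw [star_add]; exact add_mem hx hy
    | neg x _ hx => rw [star_neg]; exact neg_mem hx

theorem good_circ {x y : U} (hx : B.Good a b c x) (hy : B.Good a b c y) :
    B.Good a b c (B.circ x y) := by
  constructor
  · intro i z hz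
    rw [circ_star]
    exact add_mem (add_mem (hx.1 i z hz) (hy.1 i z hz))
      (B.Fs_le a b c _ (hx.1 _ _ (hy.1 i z hz)))
  · intro z hz
    rw [circ_star]
    exact add_mem (add_mem (hx.2 z hz) (hy.2 z hz)) (hx.2 _ (hy.2 z hz))

theorem good_zero : B.Good a b c 0 := by
  constructor <;> intros <;> rw [zero_star] <;> exact zero_mem _

theorem Fs_anti {m k : ℕ} (h : m ≤ k) : B.Fs a b c k ≤ B.Fs a b c m :=
  antitone_nat_of_succ_le (B.Fs_le a b c) h

theorem solve {p : ℕ} (hF : B.Fs a b c p = ⊥) {x y : U} {m : ℕ} (hx : B.Good a b c x)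
    (hy : y ∈ B.Fs a b c m) :
    ∃ y' ∈ B.Fs a b c m, y' - y ∈ B.Fs a b c (m + 1) ∧ x + y = B.circ x y' := by
  have key : ∀ k, ∃ z ∈ B.Fs a b c m, z + B.star x z - y ∈ B.Fs a b c (m + k) := by
    intro k
    induction k with
    | zero =>
      refine ⟨y, hy, ?_⟩
      rw [add_sub_cancel_left]
      exact B.Fs_le a b c _ (hx.1 m y hy)
    | succ k ih =>
      obtain ⟨z, hz, he⟩ := ih
      refine ⟨z - (z + B.star x z - y), sub_mem hz (B.Fs_anti a b c (by omega) he), ?_⟩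
      have h := neg_mem (hx.1 _ _ he)
      rw [star_sub]
      generalize B.star x (z + B.star x z - y) = t at h ⊢
      have e : ∀ s : U, z - (z + s - y) + (s - t) - y = -t := by intro s; abel
      rw [e]
      exact h
  obtain ⟨z, hz, he⟩ := key p
  have he' := B.Fs_anti a b c (by omega : p ≤ m + p) he
  rw [hF, AddSubgroup.mem_bot] at he'
  have hy' : y = z + B.star x z := (sub_eq_zero.1 he').symm
  refine ⟨z, hz, ?_, ?_⟩
  · have h := neg_mem (hx.1 m z hz)
    convert h using 1
    rw [hy']; abel
  · rw [circ_lam, lam_star, hy']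

theorem all_good {p N : ℕ} (hF : B.Fs a b c p = ⊥) (hN : 0 < N) (hU : ∀ x : U, N • x = 0)
    (k : ℕ) : ∀ m, m + k = p → ∀ x ∈ B.Fs a b c m, B.Good a b c x := by
  induction k with
  | zero =>
    intro m hm x hx
    rw [add_zero] at hm
    rw [hm, hF, AddSubgroup.mem_bot] at hx
    rw [hx]
    exact B.good_zero a b c
  | succ k ih =>
    intro m hm
    have IH := ih (m + 1) (by omega)
    have hadd : ∀ x y, y ∈ B.Fs a b c m → B.Good a b c x → B.Good a b c y →
        B.Good a b c (x + y) := by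
      intro x y hy gx gy
      obtain ⟨y', hy', hr, he⟩ := B.solve a b c hF gx hy
      obtain ⟨r', hr', _, he'⟩ := B.solve a b c hF gy hr
      rw [add_sub_cancel] at he'
      rw [he, he']
      exact B.good_circ a b c gx (B.good_circ a b c gy (IH r' hr'))
    intro x hx
    induction hx using AddSubgroup.closure_induction with
    | mem x hx =>
      obtain ⟨w, h1, _, rfl⟩ := hx
      exact B.good_word a b c w h1
    | zero => exact B.good_zero a b c
    | add x y _ hy gx gy => exact hadd x y hy gx gy
    | neg x hx gx =>
      have hs : ∀ j : ℕ, B.Good a b c (j • x) := by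
        intro j
        induction j with
        | zero => rw [zero_smul]; exact B.good_zero a b c
        | succ j ihj => rw [succ_nsmul]; exact hadd _ _ hx ihj gx
      have : -x = (N - 1) • x := by
        rw [neg_eq_iff_add_eq_zero, ← succ_nsmul', Nat.sub_add_cancel hN, hU]
      rw [this]
      exact hs _

theorem main_abs {p N : ℕ} (hp : 1 ≤ p) (hN : 0 < N) (hU : ∀ x : U, N • x = 0)
    (hw : ∀ w, wCount (2 : Fin 3) w = 0 → p ≤ wLen w → wEval B.star ![a, b, c] w = 0) :
    B.star (a + b) c - (B.star a c + B.star b c + B.star a (B.star b c) - B.star (B.star a b) c)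
      ∈ B.Vs a b c := by
  have hF : B.Fs a b c p = ⊥ := by
    rw [Fs, AddSubgroup.closure_eq_bot_iff]
    rintro z ⟨w, h1, h2, rfl⟩
    exact hw w h1 h2
  have ga : a ∈ B.Fs a b c 1 :=
    AddSubgroup.subset_closure ⟨FreeMagma.of 0, rfl, le_rfl, rfl⟩
  have gb : b ∈ B.Fs a b c 1 :=
    AddSubgroup.subset_closure ⟨FreeMagma.of 1, rfl, le_rfl, rfl⟩
  have gc : c ∈ B.Vs a b c :=
    AddSubgroup.subset_closure ⟨FreeMagma.of 2, ⟨rfl, rfl⟩, rfl⟩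
  have G := B.all_good a b c hF hN hU (p - 1) 1 (by omega)
  have h1 := (G a ga)
  have h2 := (G b gb)
  have h3 := (G _ (add_mem ga gb))
  have h4 := G _ (B.Fs_le a b c _ (h1.1 1 b gb))
  exact sub_mem (h3.2 c gc) (sub_mem (add_mem (add_mem (h1.2 c gc) (h2.2 c gc))
    (h1.2 _ (h2.2 c gc))) (h4.2 c gc))

end

/-- All instances of the hypotheses. -/
structure Datum (p : ℕ) : Type (u + 1) where
  n : ℕ
  hn : n < p - 1
  A : Type u
  inst : AddCommGroup A
  B : LeftBrace A
  hA : Nat.card A = p ^ n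
  a : A
  b : A
  c : A
  ha : ∃ x : A, a = p • x
  hb : ∃ y : A, b = p • y

instance {p : ℕ} (D : Datum.{u} p) : AddCommGroup D.A := D.inst

/-- Product of all braces. -/
def prodBrace (p : ℕ) : LeftBrace (∀ D : Datum.{u} p, D.A) where
  circ f g := fun D => D.B.circ (f D) (g D)
  one := fun D => D.B.one
  inv f := fun D => D.B.inv (f D)
  circ_assoc f g h := funext fun D => D.B.circ_assoc _ _ _
  one_circ f := funext fun D => D.B.one_circ _
  circ_one f := funext fun D => D.B.circ_one _
  inv_circ f := funext fun D => D.B.inv_circ _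
  circ_add f g h := funext fun D => D.B.circ_add _ _ _

theorem prod_star {p : ℕ} (f g : ∀ D : Datum.{u} p, D.A) (D : Datum.{u} p) :
    (prodBrace p).star f g D = D.B.star (f D) (g D) := rfl

theorem prod_eval {p : ℕ} (f g h : ∀ D : Datum.{u} p, D.A) (D : Datum.{u} p)
    (w : FreeMagma (Fin 3)) :
    wEval (prodBrace p).star ![f, g, h] w D = wEval D.B.star ![f D, g D, h D] w := by
  induction w using FreeMagma.rec with
  | of i => fin_cases i <;> rfl
  | mul v w hv hw =>
    show (prodBrace p).star (wEval (prodBrace p).star ![f, g, h] v)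
      (wEval (prodBrace p).star ![f, g, h] w) D = _
    rw [prod_star, hv, hw]
    rfl

end LeftBrace

/-- for a fixed prime `p` there are integers `β_w` (finitely many nonzero),
indexed by words in `X,Y,Z` (variables `0,1,2` of `Fin 3`) with `Z` exactly once at the
end, such that for every left brace of cardinality `p^n` with `n < p−1`, all
`a,b ∈ pA` and `c ∈ A`:
`(a+b)*c = a*c + b*c + a*(b*c) − (a*b)*c + Σ_w β_w·w⟨a,b,c⟩`. -/
theorem stmt_17 (p : ℕ) (hp : p.Prime) :
    ∃ (S : Finset (FreeMagma (Fin 3))) (β : FreeMagma (Fin 3) → ℤ),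
      (∀ w ∈ S, wLast w = (2 : Fin 3) ∧ wCount (2 : Fin 3) w = 1) ∧
      ∀ (n : ℕ), n < p - 1 →
        ∀ (A : Type u) [AddCommGroup A] (B : LeftBrace A), Nat.card A = p ^ n →
          ∀ a b c : A, (∃ x : A, a = p • x) → (∃ y : A, b = p • y) →
            B.star (a + b) c =
              B.star a c + B.star b c + B.star a (B.star b c) - B.star (B.star a b) c +
                ∑ w ∈ S, β w • wEval B.star ![a, b, c] w := by
  have hpp : 0 < p ^ p := pow_pos hp.pos p
  have hU : ∀ x : (∀ D : LeftBrace.Datum.{u} p, D.A), (p ^ p) • x = 0 := by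
    intro x
    funext D
    show (p ^ p) • x D = 0
    obtain ⟨k, hk⟩ : ∃ k, p = D.n + k := ⟨p - D.n, by have := D.hn; omega⟩
    have h : p ^ p = p ^ k * p ^ D.n := by
      rw [← pow_add]; congr 1; omega
    rw [h, mul_smul, ← D.hA, card_nsmul_eq_zero', smul_zero]
  have hw : ∀ w, wCount (2 : Fin 3) w = 0 → p ≤ wLen w →
      wEval (LeftBrace.prodBrace p).star
        ![fun D : LeftBrace.Datum.{u} p => D.a, fun D => D.b, fun D => D.c] w = 0 := by
    intro w h1 h2
    funext D
    rw [LeftBrace.prod_eval]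
    exact D.B.word_zero hp D.hn D.hA _ _ _ D.ha D.hb w h1 h2
  have key := (LeftBrace.prodBrace p).main_abs _ _ _ hp.one_lt.le hpp hU hw
  rw [LeftBrace.Vs, ← Submodule.span_int_eq_addSubgroupClosure, Submodule.mem_toAddSubgroup] at key
  change _ ∈ Submodule.span ℤ ((wEval (LeftBrace.prodBrace p).star
        ![fun D : LeftBrace.Datum.{u} p => D.a, fun D => D.b, fun D => D.c]) ''
        {w | wLast w = (2 : Fin 3) ∧ wCount (2 : Fin 3) w = 1}) at key
  rw [Finsupp.mem_span_image_iff_linearCombination] at key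
  obtain ⟨l, hl, hle⟩ := key
  refine ⟨l.support, l, ?_, ?_⟩
  · intro w hws
    exact (Finsupp.mem_supported ℤ l).1 hl hws
  · intro n hn A _ B hA a b c ha hb
    have h := congrFun hle ⟨n, hn, A, _, B, hA, a, b, c, ha, hb⟩
    rw [Finsupp.linearCombination_apply, Finsupp.sum, Finset.sum_apply] at h
    simp only [Pi.smul_apply, LeftBrace.prod_eval, Pi.sub_apply, Pi.add_apply,
      LeftBrace.prod_star] at h
    exact (eq_add_of_sub_eq' h.symm)
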